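/- arXiv:2602.05592 — 2 statements merged into one kernel-verified Lean document; each statement's English description precedes it below -/
import Mathlib

section
/- Let G be a real q×p matrix such that G·Gᵀ is invertible (G has full row rank), let K be an invertible real p×p matrix, let A be an invertible real p×p matrix, and let B be a real p×p matrix such that Ω := G·A⁻¹·B·A⁻¹·Gᵀ is invertible. Define G⁺ := Gᵀ·(G·Gᵀ)⁻¹, S := G·(−A)⁻¹·Gᵀ, and the reparametrized quantities G₊ := G·K, A₊ := Kᵀ·A·K, B₊ := Kᵀ·B·K, S₊ := G₊·(−A₊)⁻¹·G₊ᵀ, Ω₊ := G₊·A₊⁻¹·B₊·A₊⁻¹·G₊ᵀ, and G₊⁺ := G₊ᵀ·(G₊·G₊ᵀ)⁻¹. Assume condition B2 holds: G₊⁺ = K⁻¹·G⁺. Then for every vector u ∈ ℝᵖ and every vector v ∈ ℝ^q, one has (Kᵀu)ᵀ · G₊⁺ · S₊ · Ω₊⁻¹ · v = uᵀ · G⁺ · S · Ω⁻¹ · v. (This is the invariance of the bilinear form statistic BF_n under the reparametrization: here u plays the role of the gradient ∂Q_n(θ̃)/∂θ, Kᵀu is the transformed gradient as in assumption B3, and v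 = g(θ̂) = g₊(θ̂₊) as in assumption B6.) -/
open Matrix

/-- The inverse of a matrix congruent to `M` is congruent to `M⁻¹`. -/
theorem Matrix.mul_inv_congruence_mul_transpose {n R : Type*} [Fintype n] [DecidableEq n]
    [CommRing R] {K : Matrix n n R} (hK : IsUnit K.det) (M : Matrix n n R) :
    K * (Kᵀ * M * K)⁻¹ * Kᵀ = M⁻¹ := by
  have hKt : IsUnit Kᵀ.det := by rwa [det_transpose]
  rw [Matrix.mul_inv_rev, Matrix.mul_inv_rev, mul_nonsing_inv_cancel_left _ _ hK,
    nonsing_inv_mul_cancel_right _ _ hKt]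

/-- Invariance of the bilinear form statistic under reparametrization.
`G` is the `q × p` Jacobian of the constraint (full row rank, i.e. `G * Gᵀ` invertible),
`K` the invertible Jacobian of the inverse reparametrization, `A` the invertible
limit Hessian, `B` the asymptotic covariance with `Ω = G A⁻¹ B A⁻¹ Gᵀ` invertible.
Under assumption B2, `(GK)⁺ = K⁻¹ G⁺`, the bilinear form
`(Kᵀu)ᵀ G₊⁺ S₊ Ω₊⁻¹ v` equals `uᵀ G⁺ S Ω⁻¹ v`. -/
theorem bilinear_form_invariance
    {p q : ℕ}
    (G : Matrix (Fin q) (Fin p) ℝ)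
    (K A B : Matrix (Fin p) (Fin p) ℝ)
    (hGGt : IsUnit (G * Gᵀ).det)
    (hK : IsUnit K.det)
    (hA : IsUnit A.det)
    (hΩ : IsUnit (G * A⁻¹ * B * A⁻¹ * Gᵀ).det)
    (hB2 : (G * K)ᵀ * ((G * K) * (G * K)ᵀ)⁻¹ = K⁻¹ * (Gᵀ * (G * Gᵀ)⁻¹))
    (u : Fin p → ℝ) (v : Fin q → ℝ) :
    (Kᵀ *ᵥ u) ⬝ᵥ
      (((G * K)ᵀ * ((G * K) * (G * K)ᵀ)⁻¹
        * ((G * K) * (-(Kᵀ * A * K))⁻¹ * (G * K)ᵀ)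
        * ((G * K) * (Kᵀ * A * K)⁻¹ * (Kᵀ * B * K) * (Kᵀ * A * K)⁻¹ * (G * K)ᵀ)⁻¹) *ᵥ v)
    = u ⬝ᵥ
      ((Gᵀ * (G * Gᵀ)⁻¹
        * (G * (-A)⁻¹ * Gᵀ)
        * (G * A⁻¹ * B * A⁻¹ * Gᵀ)⁻¹) *ᵥ v) := by
  have hS : (G * K) * (-(Kᵀ * A * K))⁻¹ * (G * K)ᵀ = G * (-A)⁻¹ * Gᵀ := by
    rw [← mul_inv_congruence_mul_transpose hK (-A)]
    simp only [transpose_mul, Matrix.mul_assoc, Matrix.mul_neg, Matrix.neg_mul]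
  have hΩ_eq : (G * K) * (Kᵀ * A * K)⁻¹ * (Kᵀ * B * K) * (Kᵀ * A * K)⁻¹ * (G * K)ᵀ
      = G * A⁻¹ * B * A⁻¹ * Gᵀ := by
    rw [← mul_inv_congruence_mul_transpose hK A]
    simp only [transpose_mul, Matrix.mul_assoc]
  rw [hB2, hS, hΩ_eq, mulVec_transpose, ← dotProduct_mulVec, mulVec_mulVec]
  simp only [Matrix.mul_assoc, mul_nonsing_inv_cancel_left _ _ hK]
end

section
/- Let G be a real q×p matrix with G·Gᵀ invertible (so G has full row rank) and let K be an invertible real p×p matrix. Define G⁺ := Gᵀ·(G·Gᵀ)⁻¹ and note that (G·K)·(G·K)ᵀ is then invertible, so that the Moore–Penrose inverse of G·K is (G·K)⁺ = (G·K)ᵀ·((G·K)·(G·K)ᵀ)⁻¹. If the Greville identity G⁺·G·K·Kᵀ = K·Kᵀ·G⁺·G holds, then (G·K)⁺ = K⁻¹·G⁺. That is, the identity G⁺GKKᵀ = KKᵀG⁺G is sufficient for assumption B2, (GK)⁺ = K⁺G⁺, where K⁺ = K⁻¹ since K is invertible. -/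
open Matrix

/-- Greville's sufficient condition for assumption B2: if `G` has full row rank
(`G Gᵀ` invertible), `K` is invertible, and the Greville identity
`G⁺ G K Kᵀ = K Kᵀ G⁺ G` holds (with `G⁺ = Gᵀ (G Gᵀ)⁻¹`), then `(G K) (G K)ᵀ` is
invertible and `(G K)⁺ = (G K)ᵀ ((G K)(G K)ᵀ)⁻¹ = K⁻¹ G⁺`. -/
theorem greville_sufficient_for_B2
    {p q : ℕ}
    (G : Matrix (Fin q) (Fin p) ℝ)
    (K : Matrix (Fin p) (Fin p) ℝ)
    (hGGt : IsUnit (G * Gᵀ).det)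
    (hK : IsUnit K.det)
    (hGrev : (Gᵀ * (G * Gᵀ)⁻¹) * G * (K * Kᵀ) = (K * Kᵀ) * ((Gᵀ * (G * Gᵀ)⁻¹) * G)) :
    IsUnit ((G * K) * (G * K)ᵀ).det ∧
    (G * K)ᵀ * ((G * K) * (G * K)ᵀ)⁻¹ = K⁻¹ * (Gᵀ * (G * Gᵀ)⁻¹) := by
  have hS : IsUnit (K * Kᵀ).det := by
    rw [det_mul, det_transpose]
    exact hK.mul hK
  have hGH : G * (Gᵀ * (G * Gᵀ)⁻¹) = 1 := by
    rw [← Matrix.mul_assoc, mul_nonsing_inv _ hGGt]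
  set H := Gᵀ * (G * Gᵀ)⁻¹ with hH
  set N := (G * Gᵀ)⁻¹ * (G * ((K * Kᵀ)⁻¹ * H)) with hN
  have hSN : K * Kᵀ * (Gᵀ * N) = H := by
    calc K * Kᵀ * (Gᵀ * N) = K * Kᵀ * (H * G) * ((K * Kᵀ)⁻¹ * H) := by
          simp only [hN, hH, Matrix.mul_assoc]
      _ = H * (G * (K * Kᵀ * (K * Kᵀ)⁻¹ * H)) := by
          rw [← hGrev]
          simp only [Matrix.mul_assoc]
      _ = H := by
          rw [mul_nonsing_inv _ hS, Matrix.one_mul, hGH, Matrix.mul_one]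
  have hTN : (G * K)ᵀ * N = K⁻¹ * H := by
    rw [← hSN, transpose_mul, Matrix.mul_assoc K, nonsing_inv_mul_cancel_left _ _ hK,
      Matrix.mul_assoc]
  have hinv : (G * K) * (G * K)ᵀ * N = 1 := by
    rw [Matrix.mul_assoc, hTN, Matrix.mul_assoc, mul_nonsing_inv_cancel_left _ _ hK, hGH]
  exact ⟨isUnit_det_of_right_inverse hinv, by rw [inv_eq_right_inv hinv, hTN]⟩
end
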